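/- Let X be an h-homogeneous compact Hausdorff space, let R, S be closed relations on X with Dom R = Ran R = X and Dom S = Ran S = X, and let λ and γ be finite partitions of X into clopen sets. Then there exist self-homeomorphisms f, g of X such that M(γ, f) = M(γ, R), M(γ, g) = M(γ, S), and M(λ, f ∘ g) = M(λ, RS). (This expresses that RS is a cluster point of the product of the traces on Aut(X) of the neighborhood filters of R and S in the space of closed relations.) -/

import Mathlib

open Set TopologicalSpace Filter
open scoped Function

/-- A compact Hausdorff space is h-homogeneous if it is nonempty, zero-dimensional
(clopen sets form a basis) and all nonempty clopen subsets are homeomorphic. -/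
def IsHHomogeneous (X : Type*) [TopologicalSpace X] : Prop :=
  Nonempty X ∧ IsTopologicalBasis {s : Set X | IsClopen s} ∧
    ∀ U V : Set X, IsClopen U → IsClopen V → U.Nonempty → V.Nonempty → Nonempty (U ≃ₜ V)

/-- Composition of relations: `relComp R S = {(x,y) : ∃ z, (x,z) ∈ S ∧ (z,y) ∈ R}`. -/
def relComp {K : Type*} (R S : Set (K × K)) : Set (K × K) :=
  {p | ∃ z, (p.1, z) ∈ S ∧ (z, p.2) ∈ R}

/-- `M(γ, R)`: the set of pairs of indices `(a, b)` such that the relation `R` meets the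
rectangle `U a × U b` of the partition `γ = {U a}`. -/
def MRel {X A : Type*} (U : A → Set X) (R : Set (X × X)) : Set (A × A) :=
  {q | (R ∩ (U q.1 ×ˢ U q.2)).Nonempty}

/-- Continuous maps on the fibres of a locally constant map glue to a continuous map. -/
theorem continuous_glue_fibers {X C Y : Type*} [TopologicalSpace X] [TopologicalSpace Y]
    {c : X → C} (hc : IsLocallyConstant c) (F : ∀ k, (c ⁻¹' {k} : Set X) → Y)
    (hF : ∀ k, Continuous (F k)) : Continuous fun x => F (c x) ⟨x, rfl⟩ := by
  rw [continuous_iff_continuousAt]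
  intro x
  have hopen : IsOpen (c ⁻¹' {c x}) := hc _
  have hon : ContinuousOn (fun y => F (c y) ⟨y, rfl⟩) (c ⁻¹' {c x}) := by
    rw [continuousOn_iff_continuous_domRestrict]
    convert hF (c x) using 1
    have hval : ∀ y k (h : c y = k), F (c y) ⟨y, rfl⟩ = F k ⟨y, h⟩ := by
      rintro y _ rfl
      rfl
    exact funext fun y => hval y.1 _ y.2
  exact hon.continuousAt (hopen.mem_nhds rfl)

/-- A nontrivial h-homogeneous space splits into any positive number of nonempty clopen sets. -/
theorem IsHHomogeneous.exists_isLocallyConstant_surjective_fin {X : Type*} [TopologicalSpace X]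
    [T2Space X] [Nontrivial X] (hX : IsHHomogeneous X) (n : ℕ) :
    ∃ q : X → Fin (n + 1), IsLocallyConstant q ∧ Function.Surjective q := by
  induction n with
  | zero =>
    obtain ⟨x⟩ := hX.1
    exact ⟨fun _ => 0, IsLocallyConstant.const _, fun i => ⟨x, (Fin.fin_one_eq_zero i).symm⟩⟩
  | succ n ih =>
    obtain ⟨q, hq, hqs⟩ := ih
    obtain ⟨x, y, hxy⟩ := exists_pair_ne X
    obtain ⟨D, hD, hxD, hDy⟩ :=
      hX.2.1.exists_subset_of_mem_open (show x ∈ ({y}ᶜ : Set X) from hxy) isOpen_compl_singleton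
    have hyD : y ∉ D := fun h => hDy h rfl
    obtain ⟨e⟩ := hX.2.2 D Set.univ hD isClopen_univ ⟨x, hxD⟩ ⟨x, trivial⟩
    classical
    refine ⟨fun z => if h : z ∈ D then (q (e ⟨z, h⟩).1).succ else 0, ?_, ?_⟩
    · have hc : Continuous q := hq.continuous
      rw [IsLocallyConstant.iff_continuous]
      refine continuous_iff_continuousAt.2 fun z => ?_
      by_cases hz : z ∈ D
      · refine ContinuousOn.continuousAt (s := D) ?_ (hD.isOpen.mem_nhds hz)
        rw [continuousOn_iff_continuous_domRestrict]
        have : Continuous fun z : D => (q (e z).1).succ :=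
          (continuous_of_discreteTopology (f := Fin.succ)).comp
            (hc.comp (continuous_subtype_val.comp e.continuous))
        convert this using 1
        funext ⟨z, hz⟩
        simp [hz]
      · refine ContinuousOn.continuousAt (s := Dᶜ) ?_ (hD.compl.isOpen.mem_nhds hz)
        refine (continuousOn_const (c := 0)).congr fun w hw => ?_
        exact dif_neg hw
    · intro i
      refine Fin.cases ⟨y, by simp [hyD]⟩ (fun j => ?_) i
      obtain ⟨z, rfl⟩ := hqs j
      exact ⟨e.symm ⟨z, trivial⟩, by simp⟩

/-- In a nontrivial h-homogeneous space, a locally constant map lifts to a surjective locally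
constant map along any map from a finite type with the same range. -/
theorem IsHHomogeneous.exists_isLocallyConstant_surjective_lift {X W C : Type*}
    [TopologicalSpace X] [T2Space X] [Nontrivial X] [Finite W] (hX : IsHHomogeneous X)
    {c : X → C} (hc : IsLocallyConstant c) {φ : W → C} (hr : range c = range φ) :
    ∃ p : X → W, IsLocallyConstant p ∧ Function.Surjective p ∧ ∀ x, φ (p x) = c x := by
  have key : ∀ k, ∃ q : (c ⁻¹' {k} : Set X) → {w // φ w = k},
      IsLocallyConstant q ∧ Function.Surjective q := by
    intro k
    by_cases hk : k ∈ range c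
    · obtain ⟨x, hx⟩ := hk
      obtain ⟨w, hw⟩ : k ∈ range φ := hr ▸ ⟨x, hx⟩
      obtain ⟨n, ⟨ε⟩⟩ := Finite.exists_equiv_fin {w // φ w = k}
      obtain _ | n := n
      · exact (ε ⟨w, hw⟩).elim0
      obtain ⟨q, hq, hqs⟩ := hX.exists_isLocallyConstant_surjective_fin n
      obtain ⟨e⟩ := hX.2.2 (c ⁻¹' {k}) Set.univ ⟨hc.isClosed_fiber k, hc.isOpen_fiber k⟩
        isClopen_univ ⟨x, hx⟩ ⟨x, trivial⟩
      exact ⟨fun z => ε.symm (q (e z).1),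
        (hq.comp_continuous (continuous_subtype_val.comp e.continuous)).comp ε.symm,
        ε.symm.surjective.comp (hqs.comp (fun z => ⟨e.symm ⟨z, trivial⟩, by simp⟩))⟩
    · have hk' : k ∉ range φ := hr ▸ hk
      exact ⟨fun z => (hk ⟨z.1, z.2⟩).elim, fun s => by
        convert isOpen_empty
        exact eq_empty_of_forall_notMem fun z => (hk ⟨z.1, z.2⟩).elim,
        fun w => (hk' ⟨w.1, w.2⟩).elim⟩
  choose q hq hqs using key
  refine ⟨fun x => (q (c x) ⟨x, rfl⟩).1, ?_, ?_, fun x => (q (c x) ⟨x, rfl⟩).2⟩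
  · let _ : TopologicalSpace W := ⊥
    have : DiscreteTopology W := ⟨rfl⟩
    exact (IsLocallyConstant.iff_continuous _).2 <|
      continuous_glue_fibers hc (fun k z => (q k z).1)
        fun k => continuous_subtype_val.comp (hq k).continuous
  · intro w
    obtain ⟨⟨x, hx⟩, hxw⟩ := hqs (φ w) ⟨w, rfl⟩
    have hx' : c x = φ w := hx
    refine ⟨x, ?_⟩
    have hval : ∀ k (h : c x = k), (q (c x) ⟨x, rfl⟩).1 = (q k ⟨x, h⟩).1 := by
      rintro k rfl
      rfl
    exact (hval _ hx').trans (congrArg Subtype.val hxw)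

/-- Two surjective locally constant maps on a compact h-homogeneous space differ by a
self-homeomorphism. -/
theorem IsHHomogeneous.exists_homeomorph_comp_eq {X W : Type*} [TopologicalSpace X]
    [CompactSpace X] [T2Space X] (hX : IsHHomogeneous X) {p q : X → W}
    (hp : IsLocallyConstant p) (hq : IsLocallyConstant q) (hps : Function.Surjective p)
    (hqs : Function.Surjective q) : ∃ h : X ≃ₜ X, ∀ x, q (h x) = p x := by
  have key : ∀ w, Nonempty ((p ⁻¹' {w} : Set X) ≃ₜ (q ⁻¹' {w} : Set X)) := fun w =>
    hX.2.2 _ _ ⟨hp.isClosed_fiber w, hp.isOpen_fiber w⟩ ⟨hq.isClosed_fiber w, hq.isOpen_fiber w⟩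
      (hps w) (hqs w)
  let e := fun w => (key w).some
  let h : X ≃ X := (Equiv.sigmaFiberEquiv p).symm.trans
    ((Equiv.sigmaCongrRight fun w => (e w).toEquiv).trans (Equiv.sigmaFiberEquiv q))
  have hcont : Continuous h := continuous_glue_fibers hp (fun w z => (e w z).1)
    fun w => continuous_subtype_val.comp (e w).continuous
  exact ⟨hcont.homeoOfEquivCompactToT2, fun x => (e (p x) ⟨x, rfl⟩).2⟩

/-- The index map of a partition into open sets is locally constant. -/
theorem exists_isLocallyConstant_index {X A : Type*} [TopologicalSpace X] {U : A → Set X}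
    (hU : ∀ a, IsOpen (U a)) (hdisj : Pairwise (Disjoint on U)) (hcover : ⋃ a, U a = univ) :
    ∃ c : X → A, IsLocallyConstant c ∧ ∀ x a, x ∈ U a ↔ c x = a := by
  have hex : ∀ x, ∃ a, x ∈ U a := fun x => mem_iUnion.1 (hcover ▸ mem_univ x)
  choose c hc using hex
  have hiff : ∀ x a, x ∈ U a ↔ c x = a := by
    refine fun x a => ⟨fun hx => ?_, fun h => h ▸ hc x⟩
    by_contra hne
    exact disjoint_left.1 (hdisj hne) (hc x) hx
  refine ⟨c, (IsLocallyConstant.iff_exists_open c).2 fun x => ⟨U (c x), hU _, hc x, ?_⟩, hiff⟩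
  exact fun y hy => (hiff y _).1 hy

/-- In terms of an index map, `MRel U R` is the image of `R`. -/
theorem mem_MRel_iff {X A : Type*} {U : A → Set X} {c : X → A} (hc : ∀ x a, x ∈ U a ↔ c x = a)
    (R : Set (X × X)) (q : A × A) :
    q ∈ MRel U R ↔ ∃ x y, (x, y) ∈ R ∧ c x = q.1 ∧ c y = q.2 := by
  simp [MRel, Set.Nonempty, hc]

/-- Let `X` be an h-homogeneous compact Hausdorff space, `R, S` closed relations on `X`
with full domain and range, and `λ = {V b : b ∈ B}`, `γ = {U a : a ∈ A}` finite clopen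
partitions of `X`. Then there are self-homeomorphisms `f, g` of `X` with
`M(γ, f) = M(γ, R)`, `M(γ, g) = M(γ, S)`, and `M(λ, f ∘ g) = M(λ, RS)`.
(Thus `RS` is a cluster point of the product of the traces on `Aut(X)` of the
neighborhood filters of `R` and `S`.) -/
theorem exists_homeomorphs_approximating_relComp
    {X : Type*} [TopologicalSpace X] [CompactSpace X] [T2Space X]
    (hX : IsHHomogeneous X)
    (R S : Set (X × X)) (hRclosed : IsClosed R) (hSclosed : IsClosed S)
    (hRdom : ∀ x : X, ∃ y : X, (x, y) ∈ R) (hRran : ∀ y : X, ∃ x : X, (x, y) ∈ R)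
    (hSdom : ∀ x : X, ∃ y : X, (x, y) ∈ S) (hSran : ∀ y : X, ∃ x : X, (x, y) ∈ S)
    {A B : Type*} [Finite A] [Finite B] (U : A → Set X) (V : B → Set X)
    (hUclopen : ∀ a, IsClopen (U a)) (hUdisj : Pairwise (Disjoint on U))
    (hUcover : ⋃ a, U a = Set.univ)
    (hVclopen : ∀ b, IsClopen (V b)) (hVdisj : Pairwise (Disjoint on V))
    (hVcover : ⋃ b, V b = Set.univ) :
    ∃ f g : X ≃ₜ X,
      MRel U {p : X × X | p.2 = f p.1} = MRel U R ∧
      MRel U {p : X × X | p.2 = g p.1} = MRel U S ∧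
      MRel V {p : X × X | p.2 = f (g p.1)} = MRel V (relComp R S) := by
  obtain ⟨a, ha, haU⟩ := exists_isLocallyConstant_index (fun i => (hUclopen i).isOpen) hUdisj hUcover
  obtain ⟨b, hb, hbV⟩ := exists_isLocallyConstant_index (fun i => (hVclopen i).isOpen) hVdisj hVcover
  rcases subsingleton_or_nontrivial X with hsub | hnt
  · have hR : R = univ := eq_univ_of_forall fun p => by
      obtain ⟨y, hy⟩ := hRdom p.1
      rwa [Subsingleton.elim y p.2] at hy
    have hS : S = univ := eq_univ_of_forall fun p => by
      obtain ⟨y, hy⟩ := hSdom p.1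
      rwa [Subsingleton.elim y p.2] at hy
    have hRS : relComp R S = univ := eq_univ_of_forall fun p => ⟨p.1, by simp [hS], by simp [hR]⟩
    have hgraph : ∀ f : X → X, {p : X × X | p.2 = f p.1} = univ := fun f =>
      eq_univ_of_forall fun p => Subsingleton.elim _ _
    refine ⟨Homeomorph.refl X, Homeomorph.refl X, ?_, ?_, ?_⟩
    · rw [hgraph, hR]
    · rw [hgraph, hS]
    · rw [hgraph fun x => Homeomorph.refl X (Homeomorph.refl X x), hRS]
  let c : X → A × B := fun x => (a x, b x)
  have hc : IsLocallyConstant c := ha.prodMk hb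
  -- the cells traversed by the chains `x S z R y`
  let W : Type _ := {w : (A × B) × (A × B) × (A × B) //
    ∃ x z y, (x, z) ∈ S ∧ (z, y) ∈ R ∧ (c x, c z, c y) = w}
  have hW : ∀ {x z y}, (x, z) ∈ S → (z, y) ∈ R → ∃ w : W, w.1 = (c x, c z, c y) :=
    fun {x z y} h₁ h₂ => ⟨⟨_, x, z, y, h₁, h₂, rfl⟩, rfl⟩
  have r₁ : range c = range fun w : W => w.1.1 := by
    ext k
    constructor
    · rintro ⟨x, rfl⟩
      obtain ⟨z, hz⟩ := hSdom x
      obtain ⟨y, hy⟩ := hRdom z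
      obtain ⟨w, hw⟩ := hW hz hy
      exact ⟨w, by simp [hw]⟩
    · rintro ⟨⟨_, x, z, y, -, -, rfl⟩, rfl⟩
      exact ⟨x, rfl⟩
  have r₂ : range c = range fun w : W => w.1.2.1 := by
    ext k
    constructor
    · rintro ⟨z, rfl⟩
      obtain ⟨x, hx⟩ := hSran z
      obtain ⟨y, hy⟩ := hRdom z
      obtain ⟨w, hw⟩ := hW hx hy
      exact ⟨w, by simp [hw]⟩
    · rintro ⟨⟨_, x, z, y, -, -, rfl⟩, rfl⟩
      exact ⟨z, rfl⟩
  have r₃ : range c = range fun w : W => w.1.2.2 := by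
    ext k
    constructor
    · rintro ⟨y, rfl⟩
      obtain ⟨z, hz⟩ := hRran y
      obtain ⟨x, hx⟩ := hSran z
      obtain ⟨w, hw⟩ := hW hx hz
      exact ⟨w, by simp [hw]⟩
    · rintro ⟨⟨_, x, z, y, -, -, rfl⟩, rfl⟩
      exact ⟨y, rfl⟩
  obtain ⟨p₁, hp₁, hs₁, h₁⟩ := hX.exists_isLocallyConstant_surjective_lift hc r₁
  obtain ⟨p₂, hp₂, hs₂, h₂⟩ := hX.exists_isLocallyConstant_surjective_lift hc r₂
  obtain ⟨p₃, hp₃, hs₃, h₃⟩ := hX.exists_isLocallyConstant_surjective_lift hc r₃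
  obtain ⟨g, hg⟩ := hX.exists_homeomorph_comp_eq hp₁ hp₂ hs₁ hs₂
  obtain ⟨f, hf⟩ := hX.exists_homeomorph_comp_eq hp₂ hp₃ hs₂ hs₃
  -- the chains `x, g x, f (g x)` traverse exactly the same cells
  have hval : ∀ x, (p₁ x).1 = (c x, c (g x), c (f (g x))) := fun x => by
    rw [← h₁ x, ← h₂ (g x), ← h₃ (f (g x)), hf, hg]
  have hto : ∀ x, ∃ x' z' y', (x', z') ∈ S ∧ (z', y') ∈ R ∧
      c x' = c x ∧ c z' = c (g x) ∧ c y' = c (f (g x)) := fun x => by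
    obtain ⟨x', z', y', hS, hR, hw⟩ := (p₁ x).2
    have hw' := hw.trans (hval x)
    exact ⟨x', z', y', hS, hR, congrArg Prod.fst hw', congrArg (·.2.1) hw', congrArg (·.2.2) hw'⟩
  have hfrom : ∀ {x z y}, (x, z) ∈ S → (z, y) ∈ R →
      ∃ x', c x' = c x ∧ c (g x') = c z ∧ c (f (g x')) = c y := fun hS hR => by
    obtain ⟨w, hw⟩ := hW hS hR
    obtain ⟨x', rfl⟩ := hs₁ w
    have hw' := (hval x').symm.trans hw
    exact ⟨x', congrArg Prod.fst hw', congrArg (·.2.1) hw', congrArg (·.2.2) hw'⟩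
  have ca : ∀ {x y}, c x = c y → a x = a y := fun h => congrArg Prod.fst h
  have cb : ∀ {x y}, c x = c y → b x = b y := fun h => congrArg Prod.snd h
  refine ⟨f, g, ?_, ?_, ?_⟩ <;> ext ⟨i, j⟩
  · rw [mem_MRel_iff haU, mem_MRel_iff haU]
    constructor
    · rintro ⟨z, y, hzy, rfl, rfl⟩
      obtain rfl : y = f z := hzy
      obtain ⟨x, rfl⟩ := g.surjective z
      obtain ⟨x', z', y', -, hR, -, hz, hy⟩ := hto x
      exact ⟨z', y', hR, ca hz, ca hy⟩
    · rintro ⟨z, y, hR, rfl, rfl⟩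
      obtain ⟨x, hS⟩ := hSran z
      obtain ⟨x', -, hz, hy⟩ := hfrom hS hR
      exact ⟨g x', f (g x'), rfl, ca hz, ca hy⟩
  · rw [mem_MRel_iff haU, mem_MRel_iff haU]
    constructor
    · rintro ⟨x, z, hxz, rfl, rfl⟩
      obtain rfl : z = g x := hxz
      obtain ⟨x', z', y', hS, -, hx, hz, -⟩ := hto x
      exact ⟨x', z', hS, ca hx, ca hz⟩
    · rintro ⟨x, z, hS, rfl, rfl⟩
      obtain ⟨y, hR⟩ := hRdom z
      obtain ⟨x', hx, hz, -⟩ := hfrom hS hR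
      exact ⟨x', g x', rfl, ca hx, ca hz⟩
  · rw [mem_MRel_iff hbV, mem_MRel_iff hbV]
    constructor
    · rintro ⟨x, y, hxy, rfl, rfl⟩
      obtain rfl : y = f (g x) := hxy
      obtain ⟨x', z', y', hS, hR, hx, -, hy⟩ := hto x
      exact ⟨x', y', ⟨z', hS, hR⟩, cb hx, cb hy⟩
    · rintro ⟨x, y, ⟨z, hS, hR⟩, rfl, rfl⟩
      obtain ⟨x', hx, -, hy⟩ := hfrom hS hR
      exact ⟨x', f (g x'), rfl, cb hx, cb hy⟩
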